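/- Let X be a proper metric space in which every pair of points is joined by a geodesic and all geodesic triangles are δ-thin, and let G be a group acting by isometries on X with the action properly discontinuous, free (g·x = x implies g = 1), and cocompact (there is a compact set K ⊆ X such that every point of X is carried into K by some element of G). Then no element of G is parabolic: for every g ∈ G of infinite order and every basepoint x₀ ∈ X, the stable translation length lim_{n→∞} dist(x₀, gⁿ·x₀)/n exists and is strictly positive. -/

import Mathlib

open Filter Topology

/-- A geodesic from `a` to `b` in a metric space. -/
def IsGeodesic {X : Type*} [MetricSpace X] (g : ℝ → X) (a b : X) : Prop :=
  g 0 = a ∧ g (dist a b) = b ∧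
    ∀ s ∈ Set.Icc (0 : ℝ) (dist a b), ∀ t ∈ Set.Icc (0 : ℝ) (dist a b),
      dist (g s) (g t) = |s - t|

/-- Geodesic triangles in `X` are `δ`-thin. -/
def ThinTriangles (X : Type*) [MetricSpace X] (δ : ℝ) : Prop :=
  ∀ (a b c : X) (g₁ g₂ g₃ : ℝ → X),
    IsGeodesic g₁ a b → IsGeodesic g₂ b c → IsGeodesic g₃ a c →
    ∀ s ∈ Set.Icc (0 : ℝ) (dist a b),
      Metric.infDist (g₁ s)
        (g₂ '' Set.Icc (0 : ℝ) (dist b c) ∪ g₃ '' Set.Icc (0 : ℝ) (dist a c)) ≤ δ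

/-- The circumradius of a set: the infimum of the radii of the closed balls containing it. -/
noncomputable def circumradius {X : Type*} [MetricSpace X] (S : Set X) : ℝ :=
  sInf {r : ℝ | ∃ c : X, ∀ x ∈ S, dist c x ≤ r}

section Circumradius

variable {X : Type*} [MetricSpace X] {S : Set X}

theorem bddBelow_circumradii (hS : S.Nonempty) :
    BddBelow {r : ℝ | ∃ c : X, ∀ x ∈ S, dist c x ≤ r} := by
  obtain ⟨x, hx⟩ := hS
  exact ⟨0, fun r ⟨c, hc⟩ => dist_nonneg.trans (hc x hx)⟩

theorem circumradius_le (hS : S.Nonempty) {c : X} {r : ℝ} (h : ∀ x ∈ S, dist c x ≤ r) :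
    circumradius S ≤ r :=
  csInf_le (bddBelow_circumradii hS) ⟨c, h⟩

theorem circumradius_nonneg : 0 ≤ circumradius S := by
  rcases S.eq_empty_or_nonempty with rfl | ⟨x, hx⟩
  · by_cases hX : Nonempty X
    · simp [circumradius]
    · simp [circumradius, not_nonempty_iff.mp hX]
  · exact Real.sInf_nonneg fun r ⟨c, hc⟩ => dist_nonneg.trans (hc x hx)

theorem exists_dist_le_circumradius_add (hb : Bornology.IsBounded S) (c₀ : X) {ε : ℝ}
    (hε : 0 < ε) : ∃ c : X, ∀ x ∈ S, dist c x ≤ circumradius S + ε := by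
  obtain ⟨r, hr⟩ := hb.subset_closedBall c₀
  have hne : {r : ℝ | ∃ c : X, ∀ x ∈ S, dist c x ≤ r}.Nonempty :=
    ⟨r, c₀, fun x hx => by simpa [dist_comm] using hr hx⟩
  obtain ⟨r', ⟨c, hc⟩, hr'⟩ := exists_lt_of_csInf_lt hne (lt_add_of_pos_right _ hε)
  exact ⟨c, fun x hx => (hc x hx).trans hr'.le⟩

/-- In a space with thin triangles, the midpoint of two points `a`, `b` is closer to any third
point than the farther of `a` and `b`, by half of `dist a b` up to a bounded error. -/
theorem exists_midpoint_dist_le {δ : ℝ} (hgeo : ∀ a b : X, ∃ g : ℝ → X, IsGeodesic g a b)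
    (hthin : ThinTriangles X δ) (a b : X) :
    ∃ m : X, ∀ x : X, dist m x ≤ max (dist a x) (dist b x) + 2 * (δ + 1) - dist a b / 2 := by
  obtain ⟨γ, hγ⟩ := hgeo a b
  have hd : 0 ≤ dist a b := dist_nonneg
  have hmid : dist a b / 2 ∈ Set.Icc (0 : ℝ) (dist a b) := ⟨by linarith, by linarith⟩
  have ham : dist a (γ (dist a b / 2)) = dist a b / 2 := by
    have h := hγ.2.2 0 ⟨le_rfl, hd⟩ _ hmid
    rwa [hγ.1, zero_sub, abs_neg, abs_of_nonneg (by linarith)] at h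
  have hbm : dist b (γ (dist a b / 2)) = dist a b / 2 := by
    have h := hγ.2.2 (dist a b) ⟨hd, le_rfl⟩ _ hmid
    rw [hγ.2.1, abs_of_nonneg (by linarith)] at h
    linarith
  set m := γ (dist a b / 2)
  refine ⟨m, fun x => ?_⟩
  have key : ∀ (c : X) (η : ℝ → X), IsGeodesic η c x → ∀ t ∈ Set.Icc (0 : ℝ) (dist c x),
      dist m (η t) < δ + 1 → dist m x ≤ dist c x + 2 * (δ + 1) - dist c m := by
    intro c η hη t ht hm
    have h₁ := hη.2.2 0 ⟨le_rfl, dist_nonneg⟩ t ht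
    have h₂ := hη.2.2 t ht (dist c x) ⟨dist_nonneg, le_rfl⟩
    rw [hη.1, zero_sub, abs_neg, abs_of_nonneg ht.1] at h₁
    rw [hη.2.1, abs_sub_comm, abs_of_nonneg (by linarith [ht.2])] at h₂
    have h₃ := dist_triangle m (η t) x
    have h₄ := dist_triangle c (η t) m
    rw [dist_comm (η t) m] at h₄
    linarith
  obtain ⟨η₂, hη₂⟩ := hgeo b x
  obtain ⟨η₃, hη₃⟩ := hgeo a x
  have hlt : Metric.infDist m (η₂ '' Set.Icc (0 : ℝ) (dist b x) ∪
      η₃ '' Set.Icc (0 : ℝ) (dist a x)) < δ + 1 :=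
    (hthin a b x γ η₂ η₃ hγ hη₂ hη₃ _ hmid).trans_lt (lt_add_one δ)
  have hne : (η₂ '' Set.Icc (0 : ℝ) (dist b x) ∪ η₃ '' Set.Icc (0 : ℝ) (dist a x)).Nonempty :=
    ⟨η₂ 0, Or.inl ⟨0, ⟨le_rfl, dist_nonneg⟩, rfl⟩⟩
  obtain ⟨p, ⟨t, ht, rfl⟩ | ⟨t, ht, rfl⟩, hp⟩ := (Metric.infDist_lt_iff hne).mp hlt
  · linarith [key b η₂ hη₂ t ht hp, le_max_right (dist a x) (dist b x)]
  · linarith [key a η₃ hη₃ t ht hp, le_max_left (dist a x) (dist b x)]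

/-- Almost-circumcentres of a set are uniformly close to each other. -/
theorem dist_le_of_forall_dist_le_circumradius_add {δ : ℝ}
    (hgeo : ∀ a b : X, ∃ g : ℝ → X, IsGeodesic g a b) (hthin : ThinTriangles X δ)
    (hS : S.Nonempty) {a b : X} {ε : ℝ} (ha : ∀ x ∈ S, dist a x ≤ circumradius S + ε)
    (hb : ∀ x ∈ S, dist b x ≤ circumradius S + ε) : dist a b ≤ 2 * ε + 4 * (δ + 1) := by
  obtain ⟨m, hm⟩ := exists_midpoint_dist_le hgeo hthin a b
  have h : circumradius S ≤ circumradius S + ε + 2 * (δ + 1) - dist a b / 2 :=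
    circumradius_le hS (c := m) fun x hx => by linarith [hm x, max_le (ha x hx) (hb x hx)]
  linarith

end Circumradius

/-- For a cocompact properly discontinuous isometric action on a proper space, the number of
group elements displacing a point by at most `C` is bounded independently of the point. -/
theorem exists_card_le_of_displacement_le {G X : Type*} [Group G] [MetricSpace X] [ProperSpace X]
    [MulAction G X] [IsIsometricSMul G X]
    (hpd : ∀ K : Set X, IsCompact K →
      Set.Finite {g : G | ((fun x : X => g • x) '' K ∩ K).Nonempty})
    (hcc : ∃ K : Set X, IsCompact K ∧ ∀ x : X, ∃ g : G, g • x ∈ K) (C : ℝ) :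
    ∃ N : ℕ, ∀ (x : X) (A : Finset G), (∀ h ∈ A, dist x (h • x) ≤ C) → A.card ≤ N := by
  obtain ⟨K, hK, hKG⟩ := hcc
  have hfin := hpd _ (hK.cthickening (r := max C 0))
  refine ⟨hfin.toFinset.card, fun x A hA => ?_⟩
  obtain ⟨k, hk⟩ := hKG x
  refine Finset.card_le_card_of_injOn (MulAut.conj k) (fun h hh => ?_)
    (MulAut.conj k).injective.injOn
  simp only [Set.Finite.coe_toFinset, Set.mem_ofPred_eq]
  refine ⟨(k * h * k⁻¹) • k • x,
    ⟨k • x, Metric.self_subset_cthickening K hk, by simp⟩, ?_⟩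
  refine Metric.mem_cthickening_of_dist_le _ (k • x) _ _ hk ?_
  rw [dist_comm, smul_smul, inv_mul_cancel_right, mul_smul, dist_smul]
  exact (hA h hh).trans (le_max_left _ _)

/-- A nonnegative sequence of sublinear growth has arbitrarily long intervals on which
it grows by at most one. -/
theorem exists_add_le_add_one_of_sublinear {R : ℕ → ℝ} (hR : ∀ n, 0 ≤ R n)
    (hlin : ∀ ε > 0, ∃ B : ℝ, ∀ n : ℕ, R n ≤ B + ε * n) (N : ℕ) :
    ∃ M, R (M + N) ≤ R M + 1 := by
  by_contra! h
  have hgrow : ∀ k : ℕ, (k : ℝ) ≤ R (k * N) := by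
    intro k
    induction k with
    | zero => simpa using hR 0
    | succ k ih =>
      have := h (k * N)
      rw [add_mul, one_mul]
      push_cast
      linarith
  obtain ⟨B, hB⟩ := hlin (1 / (2 * (N + 1))) (by positivity)
  obtain ⟨k, hk⟩ := exists_nat_gt (2 * B)
  have h₁ := (hgrow k).trans (hB (k * N))
  have h₂ : 1 / (2 * ((N : ℝ) + 1)) * ((k * N : ℕ) : ℝ) ≤ k / 2 := by
    push_cast
    rw [div_mul_eq_mul_div, div_le_div_iff₀ (by positivity) (by positivity)]
    nlinarith [(Nat.cast_nonneg k : (0 : ℝ) ≤ k)]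
  linarith

theorem exists_le_add_mul_of_tendsto_div_zero {a : ℕ → ℝ}
    (ha : Tendsto (fun n : ℕ => a n / n) atTop (𝓝 0)) {ε : ℝ} (hε : 0 < ε) :
    ∃ B : ℝ, ∀ n : ℕ, a n ≤ B + ε * n := by
  obtain ⟨n₀, hn₀⟩ := eventually_atTop.mp (ha.eventually_lt_const hε)
  obtain ⟨B, hB⟩ := (Set.finite_Iic n₀).image a |>.bddAbove
  refine ⟨max B 0, fun n => ?_⟩
  rcases le_or_gt n n₀ with h | h
  · have h₁ := hB ⟨n, h, rfl⟩
    have h₂ : 0 ≤ ε * n := by positivity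
    linarith [le_max_left B 0]
  · have hn : (0 : ℝ) < n := by exact_mod_cast (Nat.zero_le n₀).trans_lt h
    have h₁ := (div_lt_iff₀ hn).mp (hn₀ n h.le)
    linarith [le_max_right B 0]

/-- If an isometry has zero stable translation length, then any finite number of its powers
displace some common point by a uniformly bounded amount. -/
theorem exists_forall_dist_pow_smul_le {G X : Type*} [Group G] [MetricSpace X] [MulAction G X]
    [IsIsometricSMul G X] {δ : ℝ} (hgeo : ∀ a b : X, ∃ g : ℝ → X, IsGeodesic g a b)
    (hthin : ThinTriangles X δ) {g : G} {x₀ : X}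
    (hlim : Tendsto (fun n : ℕ => dist x₀ (g ^ n • x₀) / n) atTop (𝓝 0)) (N : ℕ) :
    ∃ x : X, ∀ n ≤ N, dist x (g ^ n • x) ≤ 8 * (δ + 2) := by
  set S : ℕ → Set X := fun M => (fun i : ℕ => g ^ i • x₀) '' Set.Iic M
  have hne : ∀ M, (S M).Nonempty := fun M => ⟨_, 0, Nat.zero_le M, rfl⟩
  have hbdd : ∀ M, Bornology.IsBounded (S M) := fun M =>
    ((Set.finite_Iic M).image _).isBounded
  have hlin : ∀ ε > 0, ∃ B : ℝ, ∀ n : ℕ, circumradius (S n) ≤ B + ε * n := by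
    intro ε hε
    obtain ⟨B, hB⟩ := exists_le_add_mul_of_tendsto_div_zero hlim hε
    refine ⟨B, fun n => circumradius_le (hne n) (c := x₀) ?_⟩
    rintro _ ⟨i, hi, rfl⟩
    have : ε * (i : ℝ) ≤ ε * n := by gcongr; exact hi
    linarith [hB i]
  obtain ⟨M, hM⟩ := exists_add_le_add_one_of_sublinear (fun _ => circumradius_nonneg) hlin N
  obtain ⟨c, hc⟩ := exists_dist_le_circumradius_add (hbdd (M + N)) x₀ one_pos
  have hcenter : ∀ n ≤ N, ∀ x ∈ S M, dist ((g ^ n)⁻¹ • c) x ≤ circumradius (S M) + 2 := by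
    rintro n hn _ ⟨i, hi, rfl⟩
    have h := hc (g ^ (n + i) • x₀) ⟨n + i, by simp only [Set.mem_Iic] at hi ⊢; omega, rfl⟩
    rw [← dist_smul (g ^ n), smul_inv_smul, smul_smul, ← pow_add]
    linarith
  refine ⟨c, fun n hn => ?_⟩
  have h := dist_le_of_forall_dist_le_circumradius_add hgeo hthin (hne M)
    (hcenter n hn) (hcenter 0 N.zero_le)
  rw [pow_zero, inv_one, one_smul, ← dist_smul (g ^ n), smul_inv_smul] at h
  have := dist_nonneg.trans h
  linarith

theorem subadditive_dist_pow_smul {G X : Type*} [Group G] [MetricSpace X] [MulAction G X]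
    [IsIsometricSMul G X] (g : G) (x : X) : Subadditive fun n : ℕ => dist x (g ^ n • x) := by
  intro m n
  have h := dist_triangle x (g ^ m • x) (g ^ (m + n) • x)
  rw [pow_add, mul_smul, dist_smul] at h
  simpa only [pow_add, mul_smul] using h

/-- For a properly discontinuous, free, cocompact isometric action on a
proper geodesic `δ`-hyperbolic metric space, no element is parabolic: every infinite
order element has a well-defined, strictly positive stable translation length. -/
theorem no_parabolic_elements
    {G : Type*} [Group G] {X : Type*} [MetricSpace X] [ProperSpace X] [MulAction G X]
    (δ : ℝ) (hδ : 0 ≤ δ)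
    (hgeo : ∀ a b : X, ∃ g : ℝ → X, IsGeodesic g a b)
    (hthin : ThinTriangles X δ)
    (hiso : ∀ g : G, Isometry (fun x : X => g • x))
    (hpd : ∀ K : Set X, IsCompact K →
      Set.Finite {g : G | ((fun x : X => g • x) '' K ∩ K).Nonempty})
    (hfree : ∀ (g : G) (x : X), g • x = x → g = 1)
    (hcc : ∃ K : Set X, IsCompact K ∧ ∀ x : X, ∃ g : G, g • x ∈ K)
    (g : G) (hg : ¬ IsOfFinOrder g) (x₀ : X) :
    ∃ L : ℝ, 0 < L ∧
      Tendsto (fun n : ℕ => dist x₀ (g ^ n • x₀) / n) atTop (𝓝 L) := by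
  have : IsIsometricSMul G X := ⟨hiso⟩
  have hsub := subadditive_dist_pow_smul g x₀
  have hnonneg : ∀ n : ℕ, 0 ≤ dist x₀ (g ^ n • x₀) / n := fun n => by positivity
  have hlim := hsub.tendsto_lim ⟨0, by rintro _ ⟨n, rfl⟩; exact hnonneg n⟩
  refine ⟨hsub.lim, lt_of_le_of_ne (ge_of_tendsto' hlim hnonneg) fun h0 => ?_, hlim⟩
  rw [← h0] at hlim
  obtain ⟨N, hN⟩ := exists_card_le_of_displacement_le hpd hcc (8 * (δ + 2))
  obtain ⟨x, hx⟩ := exists_forall_dist_pow_smul_le hgeo hthin hlim N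
  have hinj : Function.Injective fun n : ℕ => g ^ n :=
    injective_pow_iff_not_isOfFinOrder.mpr hg
  have hcard := hN x ((Finset.range (N + 1)).map ⟨_, hinj⟩) fun h hh => by
    obtain ⟨n, hn, rfl⟩ := Finset.mem_map.mp hh
    exact hx n (Nat.lt_succ_iff.mp (Finset.mem_range.mp hn))
  simp at hcard
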